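/- Let p > 1, λ, λ' > 1, h, h' ∈ ℝ, k ≥ 0. Let v_λ and v_{λ'} be traveling-wave profiles with parameters λ and λ' respectively (as defined in the context), and let ξ_k(τ) = 1/(1 − k e^{((p−1)/p)τ}). Define, for q > 0, w⁺(x,τ) := v_λ(x − λτ(1 − q e^{((p−1)/p)τ}) + h) + v_{λ'}(−x − λ'τ(1 − q e^{((p−1)/p)τ}) + h') + ξ_k(τ) − 2, and let L(w) := w ∂_{xx} w − (p/(p−1)) (∂_x w)² + (p−1)(w² − w) − p ∂_τ w. Then there exist q > 0 and τ₀ < 0 such that L(w⁺)(x,τ) ≤ 0 for all x ∈ ℝ and all τ ≤ τ₀; that is, w⁺ is a supersolution of the pressure equation p ∂_τ u = u ∂_{xx} u − (p/(p−1)) (∂_x u)² + (p−1)(u² − u) on ℝ × (−∞, τ₀]. -/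

import Mathlib

open Filter Asymptotics

/-- The exponent `γ_λ = (λp − √(λ²p² − 4(p−1)))/2`. -/
noncomputable def gammaExp (p lam : ℝ) : ℝ :=
  (lam * p - Real.sqrt (lam ^ 2 * p ^ 2 - 4 * (p - 1))) / 2

/-- A traveling-wave profile with parameter `λ > 1`: a C², strictly decreasing solution of
`v v'' − (p/(p−1))(v')² + λp v' + (p−1)(v² − v) = 0` with two-sided exponential bounds
at `−∞` (for `v`, `−v'`, `v''`) and the asymptotics
`v = 1 + C e^{−γ_λ y} + o(e^{−γ_λ y})`, `v' = −γ_λ C e^{−γ_λ y} + o`, `v'' = γ_λ² C e^{−γ_λ y} + o`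
as `y → +∞`. -/
def IsTravelingWaveProfile (p lam : ℝ) (v : ℝ → ℝ) : Prop :=
  ContDiff ℝ 2 v ∧ StrictAnti v ∧
  (∀ y : ℝ,
    v y * deriv (deriv v) y - p / (p - 1) * (deriv v y) ^ 2
      + lam * p * deriv v y + (p - 1) * ((v y) ^ 2 - v y) = 0) ∧
  (∃ c₁ c₂ : ℝ, 0 < c₁ ∧ c₁ ≤ c₂ ∧ ∀ y : ℝ, y ≤ 0 →
    (c₁ * Real.exp (-(p - 1) * y) ≤ v y ∧ v y ≤ c₂ * Real.exp (-(p - 1) * y)) ∧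
    (c₁ * Real.exp (-(p - 1) * y) ≤ -deriv v y ∧
      -deriv v y ≤ c₂ * Real.exp (-(p - 1) * y)) ∧
    (c₁ * Real.exp (-(p - 1) * y) ≤ deriv (deriv v) y ∧
      deriv (deriv v) y ≤ c₂ * Real.exp (-(p - 1) * y))) ∧
  (∃ C : ℝ, 0 < C ∧
    ((fun y => v y - 1 - C * Real.exp (-gammaExp p lam * y)) =o[atTop]
      fun y => Real.exp (-gammaExp p lam * y)) ∧
    ((fun y => deriv v y + gammaExp p lam * C * Real.exp (-gammaExp p lam * y)) =o[atTop]
      fun y => Real.exp (-gammaExp p lam * y)) ∧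
    ((fun y => deriv (deriv v) y
        - gammaExp p lam ^ 2 * C * Real.exp (-gammaExp p lam * y)) =o[atTop]
      fun y => Real.exp (-gammaExp p lam * y)))

/-- The candidate supersolution
`w⁺(x,τ) = v_λ(x − λτ(1 − q e^{aτ}) + h) + v_{λ'}(−x − λ'τ(1 − q e^{aτ}) + h') + ξ_k(τ) − 2`,
with `a = (p−1)/p` and `ξ_k(τ) = 1/(1 − k e^{aτ})`. -/
noncomputable def wPlus (p lam lam' h h' k q : ℝ) (v v' : ℝ → ℝ) (x τ : ℝ) : ℝ :=
  v (x - lam * τ * (1 - q * Real.exp ((p - 1) / p * τ)) + h)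
    + v' (-x - lam' * τ * (1 - q * Real.exp ((p - 1) / p * τ)) + h')
    + 1 / (1 - k * Real.exp ((p - 1) / p * τ)) - 2

/-- The pressure operator `L(w) = w w_xx − (p/(p−1)) w_x² + (p−1)(w² − w) − p w_τ`. -/
noncomputable def pressureOp (p : ℝ) (w : ℝ → ℝ → ℝ) (x τ : ℝ) : ℝ :=
  w x τ * deriv (deriv fun y => w y τ) x
    - p / (p - 1) * (deriv (fun y => w y τ) x) ^ 2
    + (p - 1) * ((w x τ) ^ 2 - w x τ)
    - p * deriv (fun s => w x s) τ

lemma gamma_facts (p lam : ℝ) (hp : 1 < p) (hlam : 1 < lam) :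
    0 < gammaExp p lam ∧ (p - 1) / p ≤ gammaExp p lam * lam := by
  have hlp : p < lam * p := by nlinarith
  have hdisc : 0 ≤ lam ^ 2 * p ^ 2 - 4 * (p - 1) := by
    nlinarith [sq_nonneg (p - 2), mul_pos (show (0:ℝ) < p by linarith) (sub_pos.2 hlp)]
  have hs := Real.sq_sqrt hdisc
  have hs0 := Real.sqrt_nonneg (lam ^ 2 * p ^ 2 - 4 * (p - 1))
  unfold gammaExp
  set s := Real.sqrt (lam ^ 2 * p ^ 2 - 4 * (p - 1)) with hsdef
  have hlt : s < lam * p := by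
    apply lt_of_pow_lt_pow_left₀ 2 (by linarith)
    rw [hs]; nlinarith
  refine ⟨by linarith, ?_⟩
  rw [div_le_iff₀ (by linarith)]
  nlinarith [sq_nonneg (lam * p - s)]

lemma profile_facts (p lam : ℝ) (hp : 1 < p) (hlam : 1 < lam) (v : ℝ → ℝ)
    (hv : IsTravelingWaveProfile p lam v) :
    ∃ K M : ℝ, 0 < K ∧ (∀ y, 1 < v y ∧ deriv v y < 0 ∧ v y - 1 ≤ K * (-deriv v y) ∧
      deriv (deriv v) y ≤ K * (-deriv v y)) ∧
      ∀ y, M ≤ y → -deriv v y ≤ K * Real.exp (-gammaExp p lam * y) := by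
  obtain ⟨hc, hanti, hode, ⟨c₁, c₂, hc1, hc12, hneg⟩, C, hC, h0, h1, h2⟩ := hv
  obtain ⟨hg, -⟩ := gamma_facts p lam hp hlam
  set g := gammaExp p lam with hgdef
  have e0 := h0.def (show 0 < C / 2 by positivity)
  have e1 := h1.def (show 0 < g * C / 2 by positivity)
  have e2 := h2.def (show (0:ℝ) < 1 by norm_num)
  obtain ⟨Y, hY⟩ := Filter.eventually_atTop.1 (e0.and (e1.and e2))
  have key : ∀ y, Y ≤ y → (C / 2 * Real.exp (-g * y) ≤ v y - 1 ∧
      v y - 1 ≤ 3 * C / 2 * Real.exp (-g * y)) ∧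
      (g * C / 2 * Real.exp (-g * y) ≤ -deriv v y ∧
      -deriv v y ≤ 3 * g * C / 2 * Real.exp (-g * y)) ∧
      deriv (deriv v) y ≤ (g ^ 2 * C + 1) * Real.exp (-g * y) := by
    intro y hy
    obtain ⟨a0, a1, a2⟩ := hY y hy
    rw [Real.norm_eq_abs, Real.norm_eq_abs, Real.abs_exp, abs_le] at a0 a1 a2
    refine ⟨⟨?_, ?_⟩, ⟨?_, ?_⟩, ?_⟩ <;> linarith [a0.1, a0.2, a1.1, a1.2, a2.1, a2.2]
  have hgt : ∀ y, 1 < v y := by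
    intro y
    have h3 := (key (max y Y) (le_max_right _ _)).1.1
    have h4 : 0 < C / 2 * Real.exp (-g * max y Y) := by positivity
    have h5 := hanti.antitone (le_max_left y Y)
    linarith
  have hle : ∀ y, deriv v y ≤ 0 := fun y => hanti.antitone.deriv_nonpos
  have hlt : ∀ y, deriv v y < 0 := by
    intro y
    refine lt_of_le_of_ne (hle y) fun h => ?_
    have hm : IsLocalMax (deriv v) y := Filter.Eventually.of_forall fun z => by
      rw [h]; exact hle z
    have hz := hm.deriv_eq_zero
    have ho := hode y
    rw [hz, h] at ho
    have := hgt y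
    nlinarith [mul_pos (show 0 < p - 1 by linarith) (mul_pos (show 0 < v y by linarith) (sub_pos.2 this))]
  have cv : Continuous v := hc.continuous
  have hc1' : ContDiff ℝ 1 (deriv v) := by
    have : ContDiff ℝ (1+1) v := by norm_num; exact hc
    exact (contDiff_succ_iff_deriv.1 this).2.2
  have cv1 : Continuous (deriv v) := hc1'.continuous
  have cv2 : Continuous (deriv (deriv v)) := hc1'.continuous_deriv le_rfl
  have hne : ∀ y, -deriv v y ≠ 0 := fun y => by have := hlt y; linarith
  obtain ⟨K1, hK1⟩ := (isCompact_Icc (a := (0:ℝ)) (b := Y)).exists_bound_of_continuousOn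
    (f := fun y => (v y - 1) / (-deriv v y))
    (((cv.sub continuous_const).div cv1.neg hne).continuousOn)
  obtain ⟨K2, hK2⟩ := (isCompact_Icc (a := (0:ℝ)) (b := Y)).exists_bound_of_continuousOn
    (f := fun y => (deriv (deriv v) y) / (-deriv v y))
    ((cv2.div cv1.neg hne).continuousOn)
  have hup : ∀ K' y, K' ≤ |K1| + |K2| + c₂ / c₁ + 3 / g + (g ^ 2 * C + 1) / (g * C / 2) + 3 * g * C / 2 →
      K' * (-deriv v y) ≤ (|K1| + |K2| + c₂ / c₁ + 3 / g + (g ^ 2 * C + 1) / (g * C / 2) + 3 * g * C / 2) * (-deriv v y) :=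
    fun K' y h => mul_le_mul_of_nonneg_right h (by linarith [hle y])
  have q1 := abs_nonneg K1
  have q2 := abs_nonneg K2
  have q3 : 0 < c₂ / c₁ := div_pos (by linarith) hc1
  have q4 : 0 < 3 / g := by positivity
  have q5 : 0 < (g ^ 2 * C + 1) / (g * C / 2) := by positivity
  have q6 : 0 < 3 * g * C / 2 := by positivity
  refine ⟨|K1| + |K2| + c₂ / c₁ + 3 / g + (g ^ 2 * C + 1) / (g * C / 2) + 3 * g * C / 2, Y,
    by positivity, ?_, ?_⟩
  · intro y
    refine ⟨hgt y, hlt y, ?_⟩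
    have hpos : 0 < -deriv v y := by linarith [hlt y]
    rcases le_total y 0 with hy | hy
    · obtain ⟨⟨b1, b2⟩, ⟨b3, b4⟩, b5, b6⟩ := hneg y hy
      have : c₂ * Real.exp (-(p - 1) * y) ≤ c₂ / c₁ * (-deriv v y) := by
        calc c₂ * Real.exp (-(p - 1) * y) = c₂ / c₁ * (c₁ * Real.exp (-(p - 1) * y)) := by
              field_simp
          _ ≤ _ := mul_le_mul_of_nonneg_left b3 q3.le
      have := hup (c₂ / c₁) y (by linarith)
      constructor <;> linarith
    · rcases le_total y Y with hy2 | hy2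
      · have a1 := le_trans (le_abs_self _) (hK1 y ⟨hy, hy2⟩)
        have a2 := le_trans (le_abs_self _) (hK2 y ⟨hy, hy2⟩)
        rw [div_le_iff₀ hpos] at a1 a2
        have u1 := hup K1 y (by linarith [le_abs_self K1])
        have u2 := hup K2 y (by linarith [le_abs_self K2])
        constructor <;> linarith
      · obtain ⟨⟨b1, b2⟩, ⟨b3, b4⟩, b5⟩ := key y hy2
        have u1 := hup (3 / g) y (by linarith)
        have u2 := hup ((g ^ 2 * C + 1) / (g * C / 2)) y (by linarith)
        have w1 := mul_le_mul_of_nonneg_left b3 q4.le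
        have w2 := mul_le_mul_of_nonneg_left b3 q5.le
        have r1 : 3 / g * (g * C / 2 * Real.exp (-g * y)) = 3 * C / 2 * Real.exp (-g * y) := by
          field_simp
        have r2 : (g ^ 2 * C + 1) / (g * C / 2) * (g * C / 2 * Real.exp (-g * y))
            = (g ^ 2 * C + 1) * Real.exp (-g * y) := by
          field_simp
        constructor <;> linarith
  · intro y hy
    refine (key y hy).2.1.2.trans ?_
    apply mul_le_mul_of_nonneg_right _ (Real.exp_pos _).le
    linarith

/-- far-side decay of one wave -/
lemma decay_bound (a g lam K h τ x s M : ℝ) (ha : 0 < a) (hg : 0 < g) (hlam : 1 < lam)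
    (hgl : a ≤ g * lam) (hK : 0 < K) (hτ : τ < 0) (hM : M ≤ -lam * τ - lam / a + h)
    (hx : 0 ≤ x)
    (hs : M ≤ x - lam * τ * (1 - 1 * Real.exp (a * τ)) + h →
      s ≤ K * Real.exp (-g * (x - lam * τ * (1 - 1 * Real.exp (a * τ)) + h))) :
    s ≤ K * Real.exp (g * (lam / a - h)) * Real.exp (a * τ) := by
  have h1 : -1 ≤ a * τ * Real.exp (a * τ) := by
    have e1 := Real.add_one_le_exp (-(a * τ))
    have e2 : Real.exp (-(a * τ)) * Real.exp (a * τ) = 1 := by rw [← Real.exp_add]; simp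
    have e3 := Real.exp_pos (a * τ)
    nlinarith
  have h2 : -(lam / a) ≤ lam * τ * Real.exp (a * τ) := by
    have : lam / a * (-1) ≤ lam / a * (a * τ * Real.exp (a * τ)) :=
      mul_le_mul_of_nonneg_left h1 (by positivity)
    have e : lam / a * (a * τ * Real.exp (a * τ)) = lam * τ * Real.exp (a * τ) := by
      field_simp
    linarith
  have h3 : -lam * τ - lam / a + h ≤ x - lam * τ * (1 - 1 * Real.exp (a * τ)) + h := by
    nlinarith
  refine (hs (hM.trans h3)).trans ?_
  rw [mul_assoc K, ← Real.exp_add]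
  apply mul_le_mul_of_nonneg_left _ hK.le
  apply Real.exp_le_exp.2
  have := mul_le_mul_of_nonneg_left h3 hg.le
  nlinarith

lemma prod_left (s t a b : ℝ) (hs : 0 ≤ s) (ht : 0 ≤ t) (ha : 0 ≤ a) (hb : 0 ≤ b)
    (h : s ≤ a) : s * t ≤ (a + b) * (s + t) := by
  have h1 := mul_le_mul_of_nonneg_right h ht
  linarith [mul_nonneg ha hs, mul_nonneg hb hs, mul_nonneg hb ht, add_mul a b (s + t),
    mul_add a s t, mul_add b s t]

lemma prod_right (s t a b : ℝ) (hs : 0 ≤ s) (ht : 0 ≤ t) (ha : 0 ≤ a) (hb : 0 ≤ b)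
    (h : t ≤ b) : s * t ≤ (a + b) * (s + t) := by
  have h1 := mul_le_mul_of_nonneg_left h hs
  linarith [mul_nonneg ha hs, mul_nonneg ha ht, mul_nonneg hb ht, add_mul a b (s + t),
    mul_add a s t, mul_add b s t, mul_comm s b]

lemma xi_bound (k ε : ℝ) (h0 : 0 ≤ k * ε) (h1 : k * ε < 1 / 2) :
    1 / (1 - k * ε) - 1 ≤ 2 * k * ε := by
  rw [sub_le_iff_le_add, div_le_iff₀ (by linarith)]
  nlinarith

/-- the algebraic core -/
lemma core_ineq (p lam lam' A B e s t a2 b2 K D k ε m : ℝ) (hp : 1 < p) (hlam : 1 < lam)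
    (hlam' : 1 < lam') (hA : 0 ≤ A) (hB : 0 ≤ B) (he : 0 ≤ e) (hs : 0 ≤ s) (ht : 0 ≤ t)
    (hK : 0 < K) (hε : 0 < ε)
    (hA' : A ≤ K * s) (hB' : B ≤ K * t) (ha2 : a2 ≤ K * s) (hb2 : b2 ≤ K * t)
    (hst : s * t ≤ D * ε * (s + t)) (hek : e ≤ 2 * k * ε)
    (hm : D * (2 * K ^ 2 + 2 * (p / (p - 1)) + 2 * (p - 1) * K ^ 2)
      + 2 * k * (K + 2 * (p - 1) * K) ≤ m) :
    (B + e) * a2 + (A + e) * b2 + 2 * (p / (p - 1)) * (s * t)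
      + 2 * (p - 1) * (A * B + A * e + B * e)
      + ε * m * p * (-(lam * s) - lam' * t) ≤ 0 := by
  have hP : 0 < p / (p - 1) := div_pos (by linarith) (by linarith)
  set P := p / (p - 1)
  have hp1 : 0 < p - 1 := by linarith
  have hD : 0 ≤ D * ε * (s + t) := (mul_nonneg hs ht).trans hst
  have i1 : B * a2 ≤ K ^ 2 * (s * t) := by
    calc B * a2 ≤ B * (K * s) := mul_le_mul_of_nonneg_left ha2 hB
      _ ≤ (K * t) * (K * s) := mul_le_mul_of_nonneg_right hB' (by positivity)
      _ = _ := by ring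
  have i2 : A * b2 ≤ K ^ 2 * (s * t) := by
    calc A * b2 ≤ A * (K * t) := mul_le_mul_of_nonneg_left hb2 hA
      _ ≤ (K * s) * (K * t) := mul_le_mul_of_nonneg_right hA' (by positivity)
      _ = _ := by ring
  have i3 : A * B ≤ K ^ 2 * (s * t) := by
    calc A * B ≤ (K * s) * (K * t) := mul_le_mul hA' hB' hB (by positivity)
      _ = _ := by ring
  have i4 : e * (a2 + b2 + 2 * (p - 1) * (A + B)) ≤ 2 * k * ε * ((K + 2 * (p - 1) * K) * (s + t)) := by
    calc _ ≤ e * ((K + 2 * (p - 1) * K) * (s + t)) := by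
          apply mul_le_mul_of_nonneg_left _ he
          nlinarith
      _ ≤ _ := mul_le_mul_of_nonneg_right hek (by positivity)
  have i5 : (2 * K ^ 2 + 2 * P + 2 * (p - 1) * K ^ 2) * (s * t)
      ≤ (2 * K ^ 2 + 2 * P + 2 * (p - 1) * K ^ 2) * (D * ε * (s + t)) :=
    mul_le_mul_of_nonneg_left hst (by positivity)
  have i3' := mul_le_mul_of_nonneg_left i3 (show 0 ≤ 2 * (p - 1) by linarith)
  have i6 := mul_le_mul_of_nonneg_right hm (show 0 ≤ ε * (s + t) by positivity)
  have hest : 0 ≤ ε * (s + t) := by positivity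
  -- lower bound of the good term
  have i7 : m * (ε * (s + t)) ≤ ε * m * p * (lam * s + lam' * t) := by
    rcases (add_nonneg hs ht).eq_or_lt with h0 | h0
    · have hs0 : s = 0 := by linarith
      have ht0 : t = 0 := by linarith
      simp [hs0, ht0]
    have hm0 : 0 ≤ m := by
      have hD0 : 0 ≤ D := by
        by_contra hcon
        have : D * ε * (s + t) < 0 := mul_neg_of_neg_of_pos (mul_neg_of_neg_of_pos (not_le.1 hcon) hε) h0
        linarith
      have hk0 : 0 ≤ k := by
        by_contra hcon
        have : k * ε < 0 := mul_neg_of_neg_of_pos (not_le.1 hcon) hε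
        linarith
      refine le_trans ?_ hm
      positivity
    have j : s + t ≤ p * (lam * s + lam' * t) := by
      have j1 : s ≤ lam * s := by nlinarith
      have j2 : t ≤ lam' * t := by nlinarith
      nlinarith
    have := mul_le_mul_of_nonneg_left j (show 0 ≤ ε * m by positivity)
    nlinarith
  nlinarith

lemma op_eq (p lam lam' h h' k : ℝ) (hp : 1 < p) (v v' : ℝ → ℝ)
    (hv : IsTravelingWaveProfile p lam v) (hv' : IsTravelingWaveProfile p lam' v')
    (x τ y z : ℝ) (hk : 1 - k * Real.exp ((p - 1) / p * τ) ≠ 0)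
    (hy : y = x - lam * τ * (1 - 1 * Real.exp ((p - 1) / p * τ)) + h)
    (hz : z = -x - lam' * τ * (1 - 1 * Real.exp ((p - 1) / p * τ)) + h') :
    pressureOp p (wPlus p lam lam' h h' k 1 v v') x τ =
      ((v' z - 1) + (1 / (1 - k * Real.exp ((p - 1) / p * τ)) - 1)) * deriv (deriv v) y
      + ((v y - 1) + (1 / (1 - k * Real.exp ((p - 1) / p * τ)) - 1)) * deriv (deriv v') z
      + 2 * (p / (p - 1)) * (-deriv v y * -deriv v' z)
      + 2 * (p - 1) * ((v y - 1) * (v' z - 1)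
        + (v y - 1) * (1 / (1 - k * Real.exp ((p - 1) / p * τ)) - 1)
        + (v' z - 1) * (1 / (1 - k * Real.exp ((p - 1) / p * τ)) - 1))
      + Real.exp ((p - 1) / p * τ) * (-1 - (p - 1) / p * τ) * p
        * (-(lam * -deriv v y) - lam' * -deriv v' z) := by
  obtain ⟨hc, -, hode, -⟩ := hv
  obtain ⟨hc', -, hode', -⟩ := hv'
  have d : ∀ {u : ℝ → ℝ}, ContDiff ℝ 2 u → Differentiable ℝ u ∧ Differentiable ℝ (deriv u) := by
    intro u hu
    have h2 : ContDiff ℝ (1+1) u := by norm_num; exact hu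
    exact ⟨hu.differentiable (by norm_num),
      (contDiff_succ_iff_deriv.1 h2).2.2.differentiable (by norm_num)⟩
  obtain ⟨d0, d1⟩ := d hc
  obtain ⟨d0', d1'⟩ := d hc'
  set a := (p - 1) / p with ha
  have hpa : p * a = p - 1 := by rw [ha]; field_simp
  set ε := Real.exp (a * τ) with hε
  have X1 : ∀ c r : ℝ, HasDerivAt (fun r : ℝ => r - c + h) 1 r := fun c r =>
    ((hasDerivAt_id r).sub_const c).add_const h
  have X2 : ∀ c r : ℝ, HasDerivAt (fun r : ℝ => -r - c + h') (-1) r := fun c r =>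
    ((hasDerivAt_id r).neg.sub_const c).add_const h'
  have D1 : (deriv fun r => wPlus p lam lam' h h' k 1 v v' r τ) = fun r =>
      deriv v (r - lam * τ * (1 - 1 * ε) + h) - deriv v' (-r - lam' * τ * (1 - 1 * ε) + h') := by
    funext r
    have A1 := (d0 (r - lam * τ * (1 - 1 * ε) + h)).hasDerivAt.comp r (X1 (lam * τ * (1 - 1 * ε)) r)
    have A2 := (d0' (-r - lam' * τ * (1 - 1 * ε) + h')).hasDerivAt.comp r
      (X2 (lam' * τ * (1 - 1 * ε)) r)
    have A3 := ((A1.add A2).add_const (1 / (1 - k * ε))).sub_const 2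
    have A4 : deriv (fun r => wPlus p lam lam' h h' k 1 v v' r τ) r = _ := A3.deriv
    rw [A4]; ring
  have D2 : deriv (deriv fun r => wPlus p lam lam' h h' k 1 v v' r τ) x =
      deriv (deriv v) y + deriv (deriv v') z := by
    rw [D1, hy, hz]
    have A1 := (d1 (x - lam * τ * (1 - 1 * ε) + h)).hasDerivAt.comp x (X1 (lam * τ * (1 - 1 * ε)) x)
    have A2 := (d1' (-x - lam' * τ * (1 - 1 * ε) + h')).hasDerivAt.comp x
      (X2 (lam' * τ * (1 - 1 * ε)) x)
    have A4 : deriv (fun r => deriv v (r - lam * τ * (1 - 1 * ε) + h)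
      - deriv v' (-r - lam' * τ * (1 - 1 * ε) + h')) x = _ := (A1.sub A2).deriv
    rw [A4]; ring
  have E : HasDerivAt (fun s => Real.exp (a * s)) (ε * a) τ := by
    have := ((hasDerivAt_id τ).const_mul a).exp
    simpa using this
  have T : ∀ l c : ℝ, HasDerivAt (fun s => c - l * s * (1 - 1 * Real.exp (a * s)))
      (-l * (1 - ε) + l * τ * (ε * a)) τ := by
    intro l c
    have := (((hasDerivAt_id τ).const_mul l).mul ((E.const_mul 1).const_sub 1)).const_sub c
    refine this.congr_deriv ?_
    simp only [id, ← hε]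
    ring
  have D3 : deriv (fun s => wPlus p lam lam' h h' k 1 v v' x s) τ =
      deriv v y * (-lam * (1 - ε) + lam * τ * (ε * a))
      + deriv v' z * (-lam' * (1 - ε) + lam' * τ * (ε * a))
      + k * (ε * a) / (1 - k * ε) ^ 2 := by
    have T1 := (T lam x).add_const h
    have T2 := (T lam' (-x)).add_const h'
    have A1 := (d0 (x - lam * τ * (1 - 1 * ε) + h)).hasDerivAt.comp τ T1
    have A2 := (d0' (-x - lam' * τ * (1 - 1 * ε) + h')).hasDerivAt.comp τ T2
    have A3 := ((E.const_mul k).const_sub 1).inv hk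
    have A4 := ((A1.add A2).add A3).sub_const 2
    have A6 := A4.deriv
    rw [hy, hz]
    rw [show (fun s => wPlus p lam lam' h h' k 1 v v' x s) = (fun s => 
      v (x - lam * s * (1 - 1 * Real.exp (a * s)) + h)
    + v' (-x - lam' * s * (1 - 1 * Real.exp (a * s)) + h')
    + (1 - k * Real.exp (a * s))⁻¹ - 2) by funext s; simp only [wPlus, one_div, ha]]
    refine Eq.trans A6 ?_
    simp only [← hε]
    ring
  have W : wPlus p lam lam' h h' k 1 v v' x τ = v y + v' z + 1 / (1 - k * ε) - 2 := by
    rw [hy, hz]; rfl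
  have o1 := hode y
  have o2 := hode' z
  unfold pressureOp
  rw [D2, D3, W, D1]
  simp only
  rw [← hy, ← hz]
  have hxi : p * (k * (ε * a) / (1 - k * ε) ^ 2) =
      (p - 1) * ((1 / (1 - k * ε)) ^ 2 - 1 / (1 - k * ε)) := by
    rw [← hpa]; field_simp; ring
  set ξ := 1 / (1 - k * ε)
  generalize k * (ε * a) / (1 - k * ε) ^ 2 = ξ' at *
  linear_combination o1 + o2 - hxi

/-- there exist `q > 0` and `τ₀ < 0` such that `w⁺` is a supersolution of
the pressure equation on `ℝ × (−∞, τ₀]`, i.e. `L(w⁺) ≤ 0` there. -/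
theorem wPlus_is_supersolution (p lam lam' h h' k : ℝ)
    (hp : 1 < p) (hlam : 1 < lam) (hlam' : 1 < lam') (hk : 0 ≤ k)
    (v v' : ℝ → ℝ)
    (hv : IsTravelingWaveProfile p lam v) (hv' : IsTravelingWaveProfile p lam' v') :
    ∃ q : ℝ, 0 < q ∧ ∃ τ₀ : ℝ, τ₀ < 0 ∧ ∀ x τ : ℝ, τ ≤ τ₀ →
      pressureOp p (wPlus p lam lam' h h' k q v v') x τ ≤ 0 := by
  obtain ⟨K1, M1, hK1, f1, g1⟩ := profile_facts p lam hp hlam v hv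
  obtain ⟨K2, M2, hK2, f2, g2⟩ := profile_facts p lam' hp hlam' v' hv'
  obtain ⟨G1, G1'⟩ := gamma_facts p lam hp hlam
  obtain ⟨G2, G2'⟩ := gamma_facts p lam' hp hlam'
  have ha : 0 < (p - 1) / p := div_pos (by linarith) (by linarith)
  refine ⟨1, one_pos, ?_⟩
  obtain ⟨D1, hD1e⟩ : ∃ D1, D1 = K1 * Real.exp (gammaExp p lam * (lam / ((p - 1) / p) - h)) := ⟨_, rfl⟩
  obtain ⟨D2, hD2e⟩ : ∃ D2, D2 = K2 * Real.exp (gammaExp p lam' * (lam' / ((p - 1) / p) - h')) := ⟨_, rfl⟩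
  have hD1 : 0 < D1 := by rw [hD1e]; positivity
  have hD2 : 0 < D2 := by rw [hD2e]; positivity
  obtain ⟨D, hD⟩ : ∃ D, D = D1 + D2 := ⟨_, rfl⟩
  obtain ⟨K, hK⟩ : ∃ K, K = K1 + K2 := ⟨_, rfl⟩
  obtain ⟨N, hN⟩ : ∃ N, N = D * (2 * K ^ 2 + 2 * (p / (p - 1)) + 2 * (p - 1) * K ^ 2)
      + 2 * k * (K + 2 * (p - 1) * K) := ⟨_, rfl⟩
  have lin : ∀ b c d : ℝ, 0 < b → ∀ᶠ τ : ℝ in atBot, d ≤ -b * τ + c := by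
    intro b c d hb
    filter_upwards [eventually_le_atBot (-(d - c) / b)] with τ hτ
    rw [le_div_iff₀ hb] at hτ
    linarith
  have ev1 := lin ((p - 1) / p) (-1) N ha
  have ev2 := lin lam (-(lam / ((p - 1) / p)) + h) M1 (by linarith)
  have ev3 := lin lam' (-(lam' / ((p - 1) / p)) + h') M2 (by linarith)
  have ev4 : ∀ᶠ τ : ℝ in atBot, k * Real.exp ((p - 1) / p * τ) < 1 / 2 := by
    have t1 : Tendsto (fun τ : ℝ => (p - 1) / p * τ) atBot atBot :=
      tendsto_id.const_mul_atBot ha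
    have t2 := (Real.tendsto_exp_atBot.comp t1).const_mul k
    rw [mul_zero] at t2
    exact t2.eventually (gt_mem_nhds (by norm_num))
  obtain ⟨b, hb⟩ := Filter.eventually_atBot.1 (ev1.and (ev2.and (ev3.and ev4)))
  refine ⟨min b (-1), lt_of_le_of_lt (min_le_right _ _) (by norm_num), ?_⟩
  intro x τ hτ
  have hτ0 : τ < 0 := by linarith [min_le_right b (-1)]
  obtain ⟨c1, c2, c3, c4⟩ := hb τ (hτ.trans (min_le_left _ _))
  rw [op_eq p lam lam' h h' k hp v v' hv hv' x τ _ _ (by linarith) rfl rfl]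
  set y := x - lam * τ * (1 - 1 * Real.exp ((p - 1) / p * τ)) + h with hy
  set z := -x - lam' * τ * (1 - 1 * Real.exp ((p - 1) / p * τ)) + h' with hz
  obtain ⟨a1, a2, a3, a4⟩ := f1 y
  obtain ⟨b1, b2, b3, b4⟩ := f2 z
  have hε := Real.exp_pos ((p - 1) / p * τ)
  have hs : 0 ≤ -deriv v y := by linarith
  have ht : 0 ≤ -deriv v' z := by linarith
  have hst : -deriv v y * -deriv v' z ≤
      D * Real.exp ((p - 1) / p * τ) * (-deriv v y + -deriv v' z) := by
    set ε := Real.exp ((p - 1) / p * τ)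
    have n1 : 0 ≤ D1 * ε := by positivity
    have n2 : 0 ≤ D2 * ε := by positivity
    have e : D * ε = D1 * ε + D2 * ε := by rw [hD]; ring
    rcases le_total 0 x with hx | hx
    · have := decay_bound ((p - 1) / p) (gammaExp p lam) lam K1 h τ x (-deriv v y) M1 ha G1 hlam
        G1' hK1 hτ0 (by linarith) hx (g1 y)
      have h1 : -deriv v y ≤ D1 * ε := by rw [hD1e]; exact this
      rw [e]
      exact prod_left _ _ _ _ hs ht n1 n2 h1
    · have := decay_bound ((p - 1) / p) (gammaExp p lam') lam' K2 h' τ (-x) (-deriv v' z) M2 ha G2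
        hlam' G2' hK2 hτ0 (by linarith) (by linarith) (g2 z)
      have h1 : -deriv v' z ≤ D2 * ε := by rw [hD2e]; exact this
      rw [e]
      exact prod_right _ _ _ _ hs ht n1 n2 h1
  have hkε : 0 ≤ k * Real.exp ((p - 1) / p * τ) := by positivity
  have hd : 0 < 1 - k * Real.exp ((p - 1) / p * τ) := by linarith
  have he : 0 ≤ 1 / (1 - k * Real.exp ((p - 1) / p * τ)) - 1 := by
    rw [sub_nonneg, le_div_iff₀ hd]; linarith
  have hek : 1 / (1 - k * Real.exp ((p - 1) / p * τ)) - 1 ≤ 2 * k * Real.exp ((p - 1) / p * τ) :=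
    xi_bound _ _ hkε c4
  have k1 : K1 * -deriv v y ≤ K * -deriv v y :=
    mul_le_mul_of_nonneg_right (by linarith) hs
  have k2 : K2 * -deriv v' z ≤ K * -deriv v' z :=
    mul_le_mul_of_nonneg_right (by linarith) ht
  exact core_ineq p lam lam' (v y - 1) (v' z - 1) _ (-deriv v y) (-deriv v' z) _ _ K D k _ _ hp
    hlam hlam' (by linarith) (by linarith) he hs ht (by linarith) hε (a3.trans k1) (b3.trans k2)
    (a4.trans k1) (b4.trans k2) hst hek (by rw [← hN]; linarith)
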